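/- arXiv:1506.03724 — 6 statements merged into one kernel-verified Lean document; each statement's English description precedes it below -/
import Mathlib

section
/- Let C be a linear [n,k,d_C] code over F_q with systematic encoder (I_k|A) and D a linear [m,l,d_D] code over F_q with systematic encoder (I_l|B). Then the product code C⊗D = { ((M, MA),(BᵀM, BᵀMA)) : M ∈ F_q^{l×k} } is a linear subspace of F_q^{m×n} of dimension kl, its minimum Hamming weight (viewing matrices as vectors of length mn) equals d_C·d_D, and every codeword N ∈ C⊗D has the property that every row of N belongs to C and every column of N belongs to D. -/
open Matrix

/-- The linear `[k + r, k]` code over `F` with systematic encoder `(I_k | A)`: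
codewords are indexed by `Fin k ⊕ Fin r` (so the length is `n = k + r`) and have
the form `(x, xA)` for an information vector `x ∈ F^k`. -/
def sysCode {F : Type*} [Field F] {k r : ℕ} (A : Matrix (Fin k) (Fin r) F) :
    Set ((Fin k ⊕ Fin r) → F) :=
  { c | ∃ x : Fin k → F, c = Sum.elim x (Matrix.vecMul x A) }

/-- The classical product code `C ⊗ D` of the codes with systematic encoders
`(I_k | A)` and `(I_l | B)`: the set of `(l + s) × (k + r)` matrices of block form
`((M, MA), (BᵀM, BᵀMA))` for `M ∈ F^{l×k}`. -/
def prodCode {F : Type*} [Field F] {k r l s : ℕ} (A : Matrix (Fin k) (Fin r) F)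
    (B : Matrix (Fin l) (Fin s) F) :
    Set (Matrix (Fin l ⊕ Fin s) (Fin k ⊕ Fin r) F) :=
  { N | ∃ M : Matrix (Fin l) (Fin k) F,
      N = Matrix.fromBlocks M (M * A) (B.transpose * M) (B.transpose * M * A) }

/-- The Hamming weight of a matrix, viewed as a vector: the number of nonzero entries. -/
def matWeight {α β F : Type*} [Fintype α] [Fintype β] [Zero F] [DecidableEq F]
    (N : Matrix α β F) : ℕ :=
  (Finset.univ.filter fun p : α × β => N p.1 p.2 ≠ 0).card

/-- The product encoder `M ↦ ((M, MA), (BᵀM, BᵀMA))` as a linear map. -/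
def prodEncoder {F : Type*} [Field F] {k r l s : ℕ} (A : Matrix (Fin k) (Fin r) F)
    (B : Matrix (Fin l) (Fin s) F) :
    Matrix (Fin l) (Fin k) F →ₗ[F] Matrix (Fin l ⊕ Fin s) (Fin k ⊕ Fin r) F where
  toFun M := Matrix.fromBlocks M (M * A) (B.transpose * M) (B.transpose * M * A)
  map_add' M N := by
    simp [Matrix.fromBlocks_add, Matrix.add_mul, Matrix.mul_add]
  map_smul' c M := by
    simp [Matrix.fromBlocks_smul]

theorem prodEncoder_injective {F : Type*} [Field F] {k r l s : ℕ}
    (A : Matrix (Fin k) (Fin r) F) (B : Matrix (Fin l) (Fin s) F) :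
    Function.Injective (prodEncoder A B) := fun _ _ h =>
  (Matrix.fromBlocks_inj.mp h).1

theorem coe_range_prodEncoder {F : Type*} [Field F] {k r l s : ℕ}
    (A : Matrix (Fin k) (Fin r) F) (B : Matrix (Fin l) (Fin s) F) :
    ((prodEncoder A B).range : Set (Matrix (Fin l ⊕ Fin s) (Fin k ⊕ Fin r) F)) =
      prodCode A B := by
  ext N
  exact exists_congr fun M => eq_comm

theorem finrank_range_prodEncoder {F : Type*} [Field F] {k r l s : ℕ}
    (A : Matrix (Fin k) (Fin r) F) (B : Matrix (Fin l) (Fin s) F) :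
    Module.finrank F (prodEncoder A B).range = k * l := by
  rw [LinearMap.finrank_range_of_inj (prodEncoder_injective A B), Module.finrank_matrix]
  simp [mul_comm]

theorem row_mem_sysCode {F : Type*} [Field F] {k r l s : ℕ} {A : Matrix (Fin k) (Fin r) F}
    {B : Matrix (Fin l) (Fin s) F} {N : Matrix (Fin l ⊕ Fin s) (Fin k ⊕ Fin r) F}
    (hN : N ∈ prodCode A B) (i : Fin l ⊕ Fin s) : (fun j => N i j) ∈ sysCode A := by
  obtain ⟨M, rfl⟩ := hN
  refine ⟨fun j => Matrix.fromBlocks M (M * A) (B.transpose * M) (B.transpose * M * A) i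
    (Sum.inl j), ?_⟩
  ext j
  rcases i with i | i <;> rcases j with j | j <;> rfl

theorem col_mem_sysCode {F : Type*} [Field F] {k r l s : ℕ} {A : Matrix (Fin k) (Fin r) F}
    {B : Matrix (Fin l) (Fin s) F} {N : Matrix (Fin l ⊕ Fin s) (Fin k ⊕ Fin r) F}
    (hN : N ∈ prodCode A B) (j : Fin k ⊕ Fin r) : (fun i => N i j) ∈ sysCode B := by
  obtain ⟨M, rfl⟩ := hN
  refine ⟨fun i => Matrix.fromBlocks M (M * A) (B.transpose * M) (B.transpose * M * A)
    (Sum.inl i) j, ?_⟩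
  ext i
  rcases i with i | i <;> rcases j with j | j <;>
    simp [Matrix.mul_assoc, Matrix.mul_apply, Matrix.vecMul, dotProduct, mul_comm]

theorem vecMulVec_mem_prodCode {F : Type*} [Field F] {k r l s : ℕ}
    {A : Matrix (Fin k) (Fin r) F} {B : Matrix (Fin l) (Fin s) F}
    {c : Fin k ⊕ Fin r → F} {d : Fin l ⊕ Fin s → F}
    (hc : c ∈ sysCode A) (hd : d ∈ sysCode B) : Matrix.vecMulVec d c ∈ prodCode A B := by
  obtain ⟨x, rfl⟩ := hc
  obtain ⟨y, rfl⟩ := hd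
  refine ⟨Matrix.vecMulVec y x, ?_⟩
  rw [Matrix.mul_vecMulVec, Matrix.vecMulVec_mul, Matrix.vecMulVec_mul, Matrix.mulVec_transpose]
  ext i j
  rcases i with i | i <;> rcases j with j | j <;> rfl

theorem vecMulVec_ne_zero_of_ne_zero {α β F : Type*} [MulZeroClass F] [NoZeroDivisors F]
    {d : α → F} {c : β → F} (hd : d ≠ 0) (hc : c ≠ 0) : Matrix.vecMulVec d c ≠ 0 := by
  obtain ⟨i, hi⟩ := Function.ne_iff.mp hd
  obtain ⟨j, hj⟩ := Function.ne_iff.mp hc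
  exact fun h => mul_ne_zero hi hj (congrFun (congrFun h i) j)

theorem matWeight_eq_sum_hammingNorm {α β F : Type*} [Fintype α] [Fintype β] [Zero F]
    [DecidableEq F] (N : Matrix α β F) :
    matWeight N = ∑ i, hammingNorm fun j => N i j := by
  simp only [matWeight, hammingNorm, Finset.card_filter, Fintype.sum_prod_type]

theorem matWeight_vecMulVec {α β F : Type*} [Fintype α] [Fintype β] [MulZeroClass F]
    [NoZeroDivisors F] [DecidableEq F] (d : α → F) (c : β → F) :
    matWeight (Matrix.vecMulVec d c) = hammingNorm c * hammingNorm d := by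
  rw [mul_comm, matWeight, hammingNorm, hammingNorm, ← Finset.card_product,
    ← Finset.filter_product, Finset.univ_product_univ]
  simp [Matrix.vecMulVec_apply]

theorem mul_le_matWeight {α β F : Type*} [Fintype α] [Fintype β] [Zero F]
    [DecidableEq F] {N : Matrix α β F} {a b : ℕ}
    (hrow : ∀ i, (fun j => N i j) ≠ 0 → a ≤ hammingNorm fun j => N i j)
    (hcol : ∀ j, (fun i => N i j) ≠ 0 → b ≤ hammingNorm fun i => N i j) (hN : N ≠ 0) :
    a * b ≤ matWeight N := by
  obtain ⟨i₀, j₀, h₀⟩ : ∃ i j, N i j ≠ 0 := by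
    by_contra! h
    exact hN (Matrix.ext h)
  calc a * b ≤ a * hammingNorm fun i => N i j₀ :=
        Nat.mul_le_mul_left _ (hcol j₀ fun h => h₀ (congrFun h i₀))
    _ = ∑ i with N i j₀ ≠ 0, a := by
        rw [Finset.sum_const, smul_eq_mul, mul_comm, hammingNorm]
    _ ≤ ∑ i with N i j₀ ≠ 0, hammingNorm fun j => N i j :=
        Finset.sum_le_sum fun i hi =>
          hrow i fun h => (Finset.mem_filter.mp hi).2 (congrFun h j₀)
    _ ≤ ∑ i, hammingNorm fun j => N i j :=
        Finset.sum_le_sum_of_subset (Finset.filter_subset _ _)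
    _ = matWeight N := (matWeight_eq_sum_hammingNorm N).symm

/-- if `C = sysCode A` is an `[n, k, d_C]` code and `D = sysCode B` is an
`[m, l, d_D]` code, then the product code `C ⊗ D` is a linear subspace of `F^{m×n}` of
dimension `k * l`, its minimum Hamming weight equals `d_C * d_D`, and every codeword has
all rows in `C` and all columns in `D`. -/
theorem stmt0 {F : Type*} [Field F] [DecidableEq F] {k r l s dC dD : ℕ}
    (A : Matrix (Fin k) (Fin r) F) (B : Matrix (Fin l) (Fin s) F)
    (hdC : ∀ c ∈ sysCode A, c ≠ 0 → dC ≤ hammingNorm c)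
    (hdC' : ∃ c ∈ sysCode A, c ≠ 0 ∧ hammingNorm c = dC)
    (hdD : ∀ c ∈ sysCode B, c ≠ 0 → dD ≤ hammingNorm c)
    (hdD' : ∃ c ∈ sysCode B, c ≠ 0 ∧ hammingNorm c = dD) :
    (∃ P : Submodule F (Matrix (Fin l ⊕ Fin s) (Fin k ⊕ Fin r) F),
        (P : Set (Matrix (Fin l ⊕ Fin s) (Fin k ⊕ Fin r) F)) = prodCode A B ∧
        Module.finrank F P = k * l)
    ∧ (∀ N ∈ prodCode A B, N ≠ 0 → dC * dD ≤ matWeight N)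
    ∧ (∃ N ∈ prodCode A B, N ≠ 0 ∧ matWeight N = dC * dD)
    ∧ (∀ N ∈ prodCode A B,
        (∀ i, (fun j => N i j) ∈ sysCode A) ∧ (∀ j, (fun i => N i j) ∈ sysCode B)) := by
  refine ⟨⟨(prodEncoder A B).range, coe_range_prodEncoder A B, finrank_range_prodEncoder A B⟩,
    fun N hN h0 => mul_le_matWeight (fun i => hdC _ (row_mem_sysCode hN i))
      (fun j => hdD _ (col_mem_sysCode hN j)) h0, ?_,
    fun N hN => ⟨row_mem_sysCode hN, col_mem_sysCode hN⟩⟩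
  obtain ⟨c, hc, hc0, rfl⟩ := hdC'
  obtain ⟨d, hd, hd0, rfl⟩ := hdD'
  exact ⟨Matrix.vecMulVec d c, vecMulVec_mem_prodCode hc hd,
    vecMulVec_ne_zero_of_ne_zero hd0 hc0, matWeight_vecMulVec d c⟩
end

section
/- Let C be a linear [n,k,d_C] code over F_q with systematic encoder (I_k|A) and D a linear [m,l,d_D] code with systematic encoder (I_l|B). Let u = (0_k, a) with a ∈ F_q^{n−k} and v = (0_l, b) with b ∈ F_q^{m−l}. If bᵀ(j_k A − j_{n−k}) = (Bᵀ j_lᵀ − j_{m−l}ᵀ) a, then the two matrix codes (C+u)⊗(D+v) := { ((M, MA + j_lᵀa),((BᵀM + bᵀj_k), (BᵀM + bᵀj_k)A + j_{m−l}ᵀa)) : M ∈ F_q^{l×k} } and (C+u)⊗̃(D+v) := { ((M, MA + j_lᵀa),((BᵀM + bᵀj_k), Bᵀ(MA + j_lᵀa) + bᵀj_{n−k})) : M ∈ F_q^{l×k} } are equal; moreover this code is systematic of dimension kl, it equals the coset (C⊗D) + U where U is the m×n matrix ((0_{l×k}, j_lᵀa),(bᵀj_k, bᵀj_k A + j_{m−l}ᵀa)),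 and every matrix in it has all rows in the coset C+u and all columns in the coset D+v. -/
open Matrix

/-- Definition (1): `(C+u) ⊗ (D+v)`, obtained by encoding the first `k` columns by `D+v`
followed by encoding all rows by `C+u`, where `u = (0_k, a)` and `v = (0_l, b)`. -/
def affProd1 {F : Type*} [Field F] {k r l s : ℕ} (A : Matrix (Fin k) (Fin r) F)
    (B : Matrix (Fin l) (Fin s) F) (a : Fin r → F) (b : Fin s → F) :
    Set (Matrix (Fin l ⊕ Fin s) (Fin k ⊕ Fin r) F) :=
  { N | ∃ M : Matrix (Fin l) (Fin k) F,
      N = Matrix.fromBlocks M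
        (M * A + Matrix.vecMulVec (fun _ : Fin l => (1 : F)) a)
        (B.transpose * M + Matrix.vecMulVec b (fun _ : Fin k => (1 : F)))
        ((B.transpose * M + Matrix.vecMulVec b (fun _ : Fin k => (1 : F))) * A
          + Matrix.vecMulVec (fun _ : Fin s => (1 : F)) a) }

/-- Definition (2): `(C+u) ⊗̃ (D+v)`, obtained by encoding the first `l` rows by `C+u`
followed by encoding all columns by `D+v`. -/
def affProd2 {F : Type*} [Field F] {k r l s : ℕ} (A : Matrix (Fin k) (Fin r) F)
    (B : Matrix (Fin l) (Fin s) F) (a : Fin r → F) (b : Fin s → F) :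
    Set (Matrix (Fin l ⊕ Fin s) (Fin k ⊕ Fin r) F) :=
  { N | ∃ M : Matrix (Fin l) (Fin k) F,
      N = Matrix.fromBlocks M
        (M * A + Matrix.vecMulVec (fun _ : Fin l => (1 : F)) a)
        (B.transpose * M + Matrix.vecMulVec b (fun _ : Fin k => (1 : F)))
        (B.transpose * (M * A + Matrix.vecMulVec (fun _ : Fin l => (1 : F)) a)
          + Matrix.vecMulVec b (fun _ : Fin r => (1 : F))) }

/-- A matrix code `S ⊆ F^{α × β}` of size `q^K` is systematic of dimension `K` if there
are `K` coordinates such that the restriction of `S` to these coordinates is all of `F^K`. -/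
def SystematicOfDim {α β F : Type*} [Fintype α] [Fintype β] [Fintype F]
    (S : Set (Matrix α β F)) (K : ℕ) : Prop :=
  S.ncard = Fintype.card F ^ K ∧
    ∃ coords : Finset (α × β), coords.card = K ∧
      ∀ f : α × β → F, ∃ N ∈ S, ∀ p ∈ coords, N p.1 p.2 = f p

/-- The two ways of filling the lower right block agree under the compatibility condition. -/
theorem lowerRight_eq {F : Type*} [Field F] {k r l s : ℕ}
    {A : Matrix (Fin k) (Fin r) F} {B : Matrix (Fin l) (Fin s) F}
    {a : Fin r → F} {b : Fin s → F}
    (hcond : Matrix.vecMulVec b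
        (Matrix.vecMul (fun _ : Fin k => (1 : F)) A - fun _ => (1 : F))
      = Matrix.vecMulVec
        (Matrix.mulVec B.transpose (fun _ : Fin l => (1 : F)) - fun _ => (1 : F)) a)
    (M : Matrix (Fin l) (Fin k) F) :
    (B.transpose * M + Matrix.vecMulVec b (fun _ : Fin k => (1 : F))) * A
        + Matrix.vecMulVec (fun _ : Fin s => (1 : F)) a
      = B.transpose * (M * A + Matrix.vecMulVec (fun _ : Fin l => (1 : F)) a)
        + Matrix.vecMulVec b (fun _ : Fin r => (1 : F)) := by
  rw [Matrix.vecMulVec_sub, Matrix.sub_vecMulVec, sub_eq_sub_iff_add_eq_add] at hcond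
  rw [Matrix.add_mul, Matrix.mul_add, Matrix.vecMulVec_mul, Matrix.mul_vecMulVec,
    Matrix.mul_assoc, add_assoc, add_assoc, hcond]

/-- A code of matrices parametrized by their upper left block is systematic. -/
theorem systematicOfDim_of_upperLeft {F : Type*} [Fintype F] {k r l s : ℕ}
    (g : Matrix (Fin l) (Fin k) F → Matrix (Fin l ⊕ Fin s) (Fin k ⊕ Fin r) F)
    (hg : ∀ M i j, g M (Sum.inl i) (Sum.inl j) = M i j) :
    SystematicOfDim { N | ∃ M, N = g M } (k * l) := by
  classical
  have hinj : Function.Injective g := fun M M' h => by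
    ext i j
    rw [← hg M, ← hg M', h]
  refine ⟨?_, Finset.univ.map
    (Function.Embedding.prodMap Function.Embedding.inl Function.Embedding.inl), ?_, fun f => ?_⟩
  · have hrange : { N | ∃ M, N = g M } = g '' Set.univ := by
      ext N
      simp [eq_comm]
    rw [hrange, Set.ncard_image_of_injective _ hinj, Set.ncard_univ]
    simp [Matrix, Nat.card_eq_fintype_card, pow_mul]
  · simp [mul_comm]
  · refine ⟨_, ⟨Matrix.of fun i j => f (Sum.inl i, Sum.inl j), rfl⟩, fun p hp => ?_⟩
    obtain ⟨⟨i, j⟩, -, rfl⟩ := Finset.mem_map.mp hp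
    exact hg _ i j

/-- Theorem 3.1: if `bᵀ(j_k A - j_{n-k}) = (Bᵀ j_lᵀ - j_{m-l}ᵀ) a`, then the
two codes `(C+u)⊗(D+v)` and `(C+u)⊗̃(D+v)` coincide; the code is systematic of dimension
`kl`, equals the coset `(C ⊗ D) + U` with `U = ((0, j_lᵀa), (bᵀj_k, bᵀj_k A + j_{m-l}ᵀa))`,
and every matrix in it has all rows in `C + u` and all columns in `D + v`. -/
theorem stmt3 {F : Type*} [Field F] [Fintype F] {k r l s : ℕ}
    (A : Matrix (Fin k) (Fin r) F) (B : Matrix (Fin l) (Fin s) F)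
    (a : Fin r → F) (b : Fin s → F)
    (hcond : Matrix.vecMulVec b
        (Matrix.vecMul (fun _ : Fin k => (1 : F)) A - fun _ => (1 : F))
      = Matrix.vecMulVec
        (Matrix.mulVec B.transpose (fun _ : Fin l => (1 : F)) - fun _ => (1 : F)) a) :
    affProd1 A B a b = affProd2 A B a b
    ∧ SystematicOfDim (affProd1 A B a b) (k * l)
    ∧ affProd1 A B a b
        = (fun N => N + Matrix.fromBlocks (0 : Matrix (Fin l) (Fin k) F)
            (Matrix.vecMulVec (fun _ : Fin l => (1 : F)) a)
            (Matrix.vecMulVec b (fun _ : Fin k => (1 : F)))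
            (Matrix.vecMulVec b (fun _ : Fin k => (1 : F)) * A
              + Matrix.vecMulVec (fun _ : Fin s => (1 : F)) a)) '' prodCode A B
    ∧ ∀ N ∈ affProd1 A B a b,
        (∀ i, ∃ c ∈ sysCode A, N i = c + Sum.elim (0 : Fin k → F) a)
        ∧ (∀ j, ∃ d ∈ sysCode B, (fun i => N i j) = d + Sum.elim (0 : Fin l → F) b) := by
  refine ⟨?_, systematicOfDim_of_upperLeft _ fun _ _ _ => rfl, ?_, ?_⟩
  · simp only [affProd1, affProd2, lowerRight_eq hcond]
  · ext N
    constructor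
    · rintro ⟨M, rfl⟩
      refine ⟨_, ⟨M, rfl⟩, ?_⟩
      simp [Matrix.fromBlocks_add, Matrix.add_mul, add_assoc]
    · rintro ⟨_, ⟨M, rfl⟩, rfl⟩
      refine ⟨M, ?_⟩
      simp [Matrix.fromBlocks_add, Matrix.add_mul, add_assoc]
  · rintro _ ⟨M, rfl⟩
    refine ⟨fun i => ?_, fun j => ?_⟩
    · rcases i with i | i
      · refine ⟨_, ⟨M i, rfl⟩, ?_⟩
        ext (j | j)
        · simp
        · simp [Matrix.vecMulVec_apply, Matrix.mul_apply, Matrix.vecMul, dotProduct]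
      · refine ⟨_, ⟨(B.transpose * M + Matrix.vecMulVec b (fun _ : Fin k => (1 : F))) i, rfl⟩, ?_⟩
        ext (j | j)
        · simp
        · rw [Matrix.fromBlocks_apply₂₂, Matrix.add_apply, Matrix.mul_apply]
          simp [Matrix.vecMulVec_apply, Matrix.vecMul, dotProduct]
    · rw [lowerRight_eq hcond]
      rcases j with j | j
      · refine ⟨_, ⟨fun i => M i j, rfl⟩, ?_⟩
        ext (i | i)
        · simp
        · simp [Matrix.vecMulVec_apply, Matrix.mul_apply, Matrix.vecMul, dotProduct, mul_comm]
      · refine ⟨_, ⟨fun i => (M * A + Matrix.vecMulVec (fun _ : Fin l => (1 : F)) a) i j, rfl⟩, ?_⟩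
        ext (i | i)
        · simp
        · rw [Matrix.fromBlocks_apply₂₂, Matrix.add_apply, Matrix.mul_apply]
          simp [Matrix.vecMulVec_apply, Matrix.vecMul, dotProduct, mul_comm]
end

section
/- Let C be a linear [n,k,d_C] code over F_q with systematic encoder (I_k|A) and D a linear [m,l,d_D] code with systematic encoder (I_l|B), and suppose the all-one vector j_n belongs to C and j_m belongs to D. Let u = (0_k, a) and v = (0_l, b). Then the matrix code (C+u)⊗(D+v) := { ((M, MA + j_lᵀa),((BᵀM + bᵀj_k), (BᵀM + bᵀj_k)A + j_{m−l}ᵀa)) : M ∈ F_q^{l×k} } is systematic of dimension kl, it equals the coset (C⊗D) + U where U = ((0_{l×k}, j_lᵀa),(bᵀj_k, bᵀj_{n−k} + j_{m−l}ᵀa)), and every matrix in it has all rows in the coset C+u and all columns in the coset D+v. -/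
open Matrix

/-- The all-one word lies in a systematic code only as the encoding of the all-one word. -/
theorem one_vecMul_of_one_mem_sysCode {F : Type*} [Field F] {k r : ℕ}
    {A : Matrix (Fin k) (Fin r) F} (h : (fun _ => (1 : F)) ∈ sysCode A) :
    Matrix.vecMul (fun _ => (1 : F)) A = fun _ => 1 := by
  obtain ⟨x, hx⟩ := h
  have hx1 : x = fun _ => 1 := by
    funext i
    simpa using (congrFun hx (Sum.inl i)).symm
  subst hx1
  funext j
  simpa using (congrFun hx (Sum.inr j)).symm

/-- A matrix code parametrized by a map whose upper left block is the free parameter is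
systematic. -/
theorem systematicOfDim_of_toBlocks₁₁ {F : Type*} [Fintype F] {k r l s : ℕ}
    (φ : Matrix (Fin l) (Fin k) F → Matrix (Fin l ⊕ Fin s) (Fin k ⊕ Fin r) F)
    (hφ : ∀ M i j, φ M (Sum.inl i) (Sum.inl j) = M i j) :
    SystematicOfDim (Set.range φ) (k * l) := by
  classical
  refine ⟨?_, Finset.univ.map (Function.Embedding.prodMap
    (Function.Embedding.inl : Fin l ↪ Fin l ⊕ Fin s)
    (Function.Embedding.inl : Fin k ↪ Fin k ⊕ Fin r)), ?_, ?_⟩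
  · have hinj : Function.Injective φ := by
      intro M M' h
      ext i j
      rw [← hφ M, ← hφ M', h]
    rw [← Set.image_univ, Set.ncard_image_of_injective _ hinj, Set.ncard_univ,
      Nat.card_eq_fintype_card]
    change Fintype.card (Fin l → Fin k → F) = _
    simp [← pow_mul]
  · simp [mul_comm]
  · intro f
    refine ⟨_, ⟨fun i j => f (Sum.inl i, Sum.inl j), rfl⟩, ?_⟩
    simp only [Finset.mem_map, Finset.mem_univ, true_and]
    rintro _ ⟨⟨i, j⟩, rfl⟩
    exact hφ _ i j

/-- Corollary 3.2, Construction I: if the all-one vector lies in `C` and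
in `D`, then `(C+u) ⊗ (D+v)` is systematic of dimension `kl`, equals the coset
`(C ⊗ D) + U` with `U = ((0, j_lᵀa), (bᵀj_k, bᵀj_{n-k} + j_{m-l}ᵀa))`, and every matrix
in it has all rows in `C + u` and all columns in `D + v`. -/
theorem stmt4 {F : Type*} [Field F] [Fintype F] {k r l s : ℕ}
    (A : Matrix (Fin k) (Fin r) F) (B : Matrix (Fin l) (Fin s) F)
    (hjC : (fun _ => (1 : F)) ∈ sysCode A)
    (hjD : (fun _ => (1 : F)) ∈ sysCode B)
    (a : Fin r → F) (b : Fin s → F) :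
    SystematicOfDim (affProd1 A B a b) (k * l)
    ∧ affProd1 A B a b
        = (fun N => N + Matrix.fromBlocks (0 : Matrix (Fin l) (Fin k) F)
            (Matrix.vecMulVec (fun _ : Fin l => (1 : F)) a)
            (Matrix.vecMulVec b (fun _ : Fin k => (1 : F)))
            (Matrix.vecMulVec b (fun _ : Fin r => (1 : F))
              + Matrix.vecMulVec (fun _ : Fin s => (1 : F)) a)) '' prodCode A B
    ∧ ∀ N ∈ affProd1 A B a b,
        (∀ i, ∃ c ∈ sysCode A, N i = c + Sum.elim (0 : Fin k → F) a)
        ∧ (∀ j, ∃ d ∈ sysCode B, (fun i => N i j) = d + Sum.elim (0 : Fin l → F) b) := by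
  have hA := one_vecMul_of_one_mem_sysCode hjC
  have hB := one_vecMul_of_one_mem_sysCode hjD
  refine ⟨?_, ?_, ?_⟩
  · convert systematicOfDim_of_toBlocks₁₁ (fun M : Matrix (Fin l) (Fin k) F =>
      Matrix.fromBlocks M
        (M * A + Matrix.vecMulVec (fun _ : Fin l => (1 : F)) a)
        (B.transpose * M + Matrix.vecMulVec b (fun _ : Fin k => (1 : F)))
        ((B.transpose * M + Matrix.vecMulVec b (fun _ : Fin k => (1 : F))) * A
          + Matrix.vecMulVec (fun _ : Fin s => (1 : F)) a)) (fun _ _ _ => rfl) using 1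
    ext N
    simp only [affProd1, Set.mem_ofPred_eq, Set.mem_range, eq_comm]
  · ext N
    constructor
    · rintro ⟨M, rfl⟩
      refine ⟨_, ⟨M, rfl⟩, ?_⟩
      simp [Matrix.fromBlocks_add, Matrix.add_mul, Matrix.vecMulVec_mul, hA, add_assoc]
    · rintro ⟨_, ⟨M, rfl⟩, rfl⟩
      refine ⟨M, ?_⟩
      simp [Matrix.fromBlocks_add, Matrix.add_mul, Matrix.vecMulVec_mul, hA, add_assoc]
  · rintro _ ⟨M, rfl⟩
    refine ⟨?_, ?_⟩
    · rintro (i | i)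
      · refine ⟨_, ⟨M i, rfl⟩, ?_⟩
        funext j
        rcases j with j | j <;> simp [Matrix.vecMulVec_apply, Matrix.mul_apply_eq_vecMul]
      · refine ⟨_, ⟨(B.transpose * M + Matrix.vecMulVec b (fun _ : Fin k => (1 : F))) i, rfl⟩, ?_⟩
        funext j
        rcases j with j | j
        · simp
        · simp [Matrix.vecMulVec_apply, Matrix.mul_apply_eq_vecMul]
    · rintro (j | j)
      · refine ⟨_, ⟨fun i => M i j, rfl⟩, ?_⟩
        funext i
        rcases i with i | i
        · simp
        · simp [Matrix.vecMulVec_apply, Matrix.mul_apply, Matrix.vecMul, dotProduct, mul_comm]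
      · refine ⟨_, ⟨(fun i => (M * A) i j) + a j • (fun _ => (1 : F)), rfl⟩, ?_⟩
        funext i
        rcases i with i | i
        · simp [Matrix.vecMulVec_apply]
        · have h : Matrix.vecMul (fun t => (M * A) t j) B i = (B.transpose * (M * A)) i j := by
            rw [Matrix.mul_apply]
            simp only [Matrix.vecMul, dotProduct, Matrix.transpose_apply, mul_comm]
          simp only [Matrix.fromBlocks_apply₂₂, Matrix.add_mul, Matrix.vecMulVec_mul, hA,
            Matrix.add_apply, Pi.add_apply, Sum.elim_inr, Matrix.add_vecMul,
            Matrix.smul_vecMul, hB, Pi.smul_apply, h, Matrix.mul_assoc,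
            Matrix.vecMulVec_apply, smul_eq_mul]
          ring
end

section
/- Let C₁ ⊂ C₂ be linear [n,k₁] and [n,k₂] codes over F_q with j_n ∈ C₁, and D₁ ⊂ D₂ linear [m,l₁] and [m,l₂] codes with j_m ∈ D₁. Let C₃ with C₁ ⊆ C₃ ⊊ C₂ be a linear code of dimension k₂−1 and D₃ with D₁ ⊆ D₃ ⊊ D₂ a linear code of dimension l₂−1, and pick u ∈ C₂ \ C₃ and v ∈ D₂ \ D₃. Then the affine product code (C₃+u)⊗(D₃+v) of Construction I is a matrix code in F_q^{m×n} of size q^{(k₂−1)(l₂−1)} such that every matrix in it has all rows in C₂ \ C₁ and all columns in D₂ \ D₁. -/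
open Matrix

/-- The translation matrix `U` of Construction I for `u = (0_k, a)`, `v = (0_l, b)`. -/
def consIU {F : Type*} [Field F] {k r l s : ℕ} (a : Fin r → F) (b : Fin s → F) :
    Matrix (Fin l ⊕ Fin s) (Fin k ⊕ Fin r) F :=
  Matrix.fromBlocks (0 : Matrix (Fin l) (Fin k) F)
    (Matrix.vecMulVec (fun _ : Fin l => (1 : F)) a)
    (Matrix.vecMulVec b (fun _ : Fin k => (1 : F)))
    (Matrix.vecMulVec b (fun _ : Fin r => (1 : F))
      + Matrix.vecMulVec (fun _ : Fin s => (1 : F)) a)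

lemma add_mem_sysCode {F : Type*} [Field F] {k r : ℕ} {A : Matrix (Fin k) (Fin r) F}
    {c d : (Fin k ⊕ Fin r) → F} (hc : c ∈ sysCode A) (hd : d ∈ sysCode A) :
    c + d ∈ sysCode A := by
  obtain ⟨x, rfl⟩ := hc
  obtain ⟨y, rfl⟩ := hd
  exact ⟨x + y, by rw [Matrix.add_vecMul]; ext (i | i) <;> rfl⟩

lemma smul_mem_sysCode {F : Type*} [Field F] {k r : ℕ} {A : Matrix (Fin k) (Fin r) F}
    {c : (Fin k ⊕ Fin r) → F} (t : F) (hc : c ∈ sysCode A) : t • c ∈ sysCode A := by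
  obtain ⟨x, rfl⟩ := hc
  exact ⟨t • x, by rw [Matrix.smul_vecMul]; ext (i | i) <;> rfl⟩

/-- A translate `c + u` of a codeword of `C₃ = sysCode A` by `u ∈ C₂ \ C₃` avoids `C₁ ⊆ C₃`. -/
lemma sysCode_add_mem_diff {F : Type*} [Field F] {k r : ℕ} {A : Matrix (Fin k) (Fin r) F}
    {C₁ C₂ : Submodule F ((Fin k ⊕ Fin r) → F)}
    (h₁ : (C₁ : Set ((Fin k ⊕ Fin r) → F)) ⊆ sysCode A)
    (h₂ : sysCode A ⊆ (C₂ : Set ((Fin k ⊕ Fin r) → F)))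
    {c u : (Fin k ⊕ Fin r) → F} (hc : c ∈ sysCode A) (hu : u ∈ (C₂ : Set _) \ sysCode A) :
    c + u ∈ (C₂ : Set _) \ (C₁ : Set _) := by
  refine ⟨C₂.add_mem (h₂ hc) hu.1, fun h => hu.2 ?_⟩
  have := add_mem_sysCode (smul_mem_sysCode (-1) hc) (h₁ h)
  simpa using this

/-- The product code `C ⊗ D` has as many elements as there are information matrices. -/
lemma ncard_prodCode {F : Type*} [Field F] [Fintype F] {k r l s : ℕ}
    (A : Matrix (Fin k) (Fin r) F) (B : Matrix (Fin l) (Fin s) F) :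
    (prodCode A B).ncard = Fintype.card F ^ (k * l) := by
  have h : prodCode A B = Set.range (fun M : Matrix (Fin l) (Fin k) F =>
      Matrix.fromBlocks M (M * A) (B.transpose * M) (B.transpose * M * A)) := by
    ext N
    simp only [prodCode, Set.mem_ofPred_eq, Set.mem_range, eq_comm]
  rw [h, Set.ncard_range_of_injective fun M M' hM => (Matrix.fromBlocks_inj.mp hM).1]
  simp [Matrix, Nat.card_eq_fintype_card, pow_mul]

/-- Construction IA: let `C₁ ⊂ C₂` be `[n,k₁]`, `[n,k₂]` codes with
`j_n ∈ C₁`, and let `C₃` (here `sysCode A`, of dimension `k₃ = k₂ - 1`, with systematic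
encoder `(I_{k₃}|A)`) satisfy `C₁ ⊆ C₃ ⊊ C₂`; similarly for `D₁ ⊂ D₂` and `D₃ = sysCode B`.
Pick `u = (0,a) ∈ C₂ \ C₃` and `v = (0,b) ∈ D₂ \ D₃`. Then the affine product code
`(C₃+u) ⊗ (D₃+v) = (C₃ ⊗ D₃) + U` of Construction I is a matrix code of size
`q^{(k₂-1)(l₂-1)}` all of whose matrices have all rows in `C₂ \ C₁` and all columns in
`D₂ \ D₁`. -/
theorem stmt7 {F : Type*} [Field F] [Fintype F] {k r l s k₁ k₂ l₁ l₂ : ℕ}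
    (A : Matrix (Fin k) (Fin r) F) (B : Matrix (Fin l) (Fin s) F)
    (C₁ C₂ : Submodule F ((Fin k ⊕ Fin r) → F))
    (D₁ D₂ : Submodule F ((Fin l ⊕ Fin s) → F))
    (hk₁ : Module.finrank F C₁ = k₁) (hk₂ : Module.finrank F C₂ = k₂)
    (hl₁ : Module.finrank F D₁ = l₁) (hl₂ : Module.finrank F D₂ = l₂)
    (hk₂' : k₂ = k + 1) (hl₂' : l₂ = l + 1)
    (hjC : (fun _ => (1 : F)) ∈ C₁) (hjD : (fun _ => (1 : F)) ∈ D₁)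
    (hC₁₃ : (C₁ : Set ((Fin k ⊕ Fin r) → F)) ⊆ sysCode A)
    (hC₃₂ : sysCode A ⊆ (C₂ : Set ((Fin k ⊕ Fin r) → F)))
    (hD₁₃ : (D₁ : Set ((Fin l ⊕ Fin s) → F)) ⊆ sysCode B)
    (hD₃₂ : sysCode B ⊆ (D₂ : Set ((Fin l ⊕ Fin s) → F)))
    (a : Fin r → F) (ha : Sum.elim (0 : Fin k → F) a ∈ (C₂ : Set _) \ sysCode A)
    (b : Fin s → F) (hb : Sum.elim (0 : Fin l → F) b ∈ (D₂ : Set _) \ sysCode B) :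
    ((fun N => N + consIU a b) '' prodCode A B).ncard
        = Fintype.card F ^ ((k₂ - 1) * (l₂ - 1))
    ∧ ∀ N ∈ (fun N => N + consIU a b) '' prodCode A B,
        (∀ i, N i ∈ (C₂ : Set _) \ (C₁ : Set _))
        ∧ (∀ j, (fun i => N i j) ∈ (D₂ : Set _) \ (D₁ : Set _)) := by
  refine ⟨?_, ?_⟩
  · rw [Set.ncard_image_of_injective _ (add_left_injective _), ncard_prodCode, hk₂', hl₂',
      Nat.add_sub_cancel, Nat.add_sub_cancel]
  · rintro _ ⟨_, ⟨M, rfl⟩, rfl⟩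
    refine ⟨?_, ?_⟩
    · have key (x : Fin k → F) (t : F) := sysCode_add_mem_diff hC₁₃ hC₃₂
        (add_mem_sysCode ⟨x, rfl⟩ (smul_mem_sysCode t (hC₁₃ hjC))) ha
      rintro (i | i)
      · convert key (M i) 0 using 1
        ext (j | j) <;>
          simp [consIU, Matrix.vecMulVec_apply, Matrix.mul_apply, Matrix.vecMul, dotProduct]
      · convert key ((B.transpose * M) i) (b i) using 1
        ext (j | j)
        · simp [consIU, Matrix.vecMulVec_apply]
        · simp [consIU, Matrix.vecMulVec_apply, Matrix.mul_apply (M := B.transpose * M),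
            Matrix.vecMul, dotProduct, add_assoc]
    · have key (y : Fin l → F) (t : F) := sysCode_add_mem_diff hD₁₃ hD₃₂
        (add_mem_sysCode ⟨y, rfl⟩ (smul_mem_sysCode t (hD₁₃ hjD))) hb
      rintro (j | j)
      · convert key (fun i => M i j) 0 using 1
        ext (i | i) <;>
          simp [consIU, Matrix.vecMulVec_apply, Matrix.mul_apply, Matrix.vecMul, dotProduct,
            mul_comm]
      · convert key (fun i => (M * A) i j) (a j) using 1
        ext (i | i)
        · simp [consIU, Matrix.vecMulVec_apply]
        · simp [consIU, Matrix.vecMulVec_apply, Matrix.mul_assoc,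
            Matrix.mul_apply (M := B.transpose), Matrix.vecMul, dotProduct, mul_comm]
          ring
end

section
/- For i ∈ [m] let C_i be a linear code of length n and dimension k_i over F_q, and for j ∈ [n] let D_j be a linear code of length n... specifically of length m and dimension l_j, with k₁ ≤ k₂ ≤ ⋯ ≤ k_m and l₁ ≤ l₂ ≤ ⋯ ≤ l_n. Suppose moreover that C₁ ⊆ C₂ ⊆ ⋯ ⊆ C_m and D₁ ⊆ D₂ ⊆ ⋯ ⊆ D_n. Then there exists a linear (m×n)-matrix code over F_q of dimension K = Σ_{j=1}^{n} Σ_{i=l_{j−1}+1}^{l_j} max{k_i − j + 1, 0} (with l₀ = 0) such that every codeword N satisfies: the i-th row of N belongs to C_i for every i ∈ [m], and the j-th column of N belongs to D_j for every j ∈ [n]. -/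
open Classical in
/-- The pivots of a subspace `W` of `F^n`: the positions of leading entries of vectors of `W`. -/
noncomputable def pivots {F : Type*} [Field F] {n : ℕ} (W : Submodule F (Fin n → F)) :
    Finset (Fin n) :=
  {j | ∃ v ∈ W, v j ≠ 0 ∧ ∀ j' < j, v j' = 0}

theorem mem_pivots {F : Type*} [Field F] {n : ℕ} {W : Submodule F (Fin n → F)} {j : Fin n} :
    j ∈ pivots W ↔ ∃ v ∈ W, v j ≠ 0 ∧ ∀ j' < j, v j' = 0 := by
  simp [pivots]

theorem pivots_mono {F : Type*} [Field F] {n : ℕ} {W W' : Submodule F (Fin n → F)}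
    (h : W ≤ W') : pivots W ⊆ pivots W' := by
  intro j
  rw [mem_pivots, mem_pivots]
  rintro ⟨v, hv, hj⟩
  exact ⟨v, h hv, hj⟩

theorem finrank_le_card_pivots {F : Type*} [Field F] {n : ℕ} (W : Submodule F (Fin n → F)) :
    Module.finrank F W ≤ (pivots W).card := by
  let f : W →ₗ[F] (pivots W → F) :=
    LinearMap.funLeft F F (Subtype.val : pivots W → Fin n) ∘ₗ W.subtype
  have hf : Function.Injective f := by
    rw [← LinearMap.ker_eq_bot, LinearMap.ker_eq_bot']
    rintro ⟨v, hv⟩ h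
    suffices ∀ j, v j = 0 by ext j; exact this j
    intro j
    induction j using WellFoundedLT.induction with
    | _ j ih =>
      by_contra hj
      exact hj (congrFun h ⟨j, mem_pivots.2 ⟨v, hv, hj, ih⟩⟩)
  simpa using LinearMap.finrank_le_finrank_of_injective hf

/-- A chain of subspaces has a simultaneous echelon basis, extended to all positions. -/
theorem exists_echelon_of_monotone {F : Type*} [Field F] {m n : ℕ}
    {C : Fin m → Submodule F (Fin n → F)} (hC : Monotone C) :
    ∃ c : Matrix (Fin n) (Fin n) F, c.IsUpperTriangular ∧ (∀ j, c j j ≠ 0) ∧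
      ∀ i j, j ∈ pivots (C i) → c j ∈ C i := by
  have key : ∀ j : Fin n, ∃ v : Fin n → F, v j ≠ 0 ∧ (∀ j' < j, v j' = 0) ∧
      ∀ i, j ∈ pivots (C i) → v ∈ C i := by
    intro j
    by_cases h : ∃ i, j ∈ pivots (C i)
    · obtain ⟨i, hi, hmin⟩ := WellFounded.has_min (wellFounded_lt (α := Fin m))
        {i | j ∈ pivots (C i)} h
      obtain ⟨v, hv, hj, hj'⟩ := mem_pivots.1 hi
      exact ⟨v, hj, hj', fun i' hi' => hC (not_lt.1 (hmin i' hi')) hv⟩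
    · exact ⟨Pi.single j 1, by simp, fun j' hj' => by simp [hj'.ne],
        fun i hi => (h ⟨i, hi⟩).elim⟩
  choose c h₁ h₂ h₃ using key
  exact ⟨c, fun i j hij => h₂ i j hij, h₁, fun i j => h₃ j i⟩

/-- Imposing the vanishing of the coordinates in `s` lowers the dimension by at most `#s`. -/
theorem finrank_le_finrank_inf_vanishing {F : Type*} [Field F] {m : ℕ}
    (D : Submodule F (Fin m → F)) (s : Finset (Fin m)) :
    Module.finrank F D ≤ Module.finrank F
      (D ⊓ LinearMap.ker (LinearMap.funLeft F F (Subtype.val : s → Fin m)) :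
        Submodule F (Fin m → F)) + s.card := by
  set g := LinearMap.funLeft F F (Subtype.val : s → Fin m)
  have h := LinearMap.finrank_range_add_finrank_ker (g.domRestrict D)
  have h₁ : Module.finrank F (LinearMap.range (g.domRestrict D)) ≤ s.card := by
    simpa using Submodule.finrank_le (LinearMap.range (g.domRestrict D))
  have h₂ : Module.finrank F (LinearMap.ker (g.domRestrict D)) =
      Module.finrank F (D ⊓ LinearMap.ker g : Submodule F (Fin m → F)) := by
    rw [LinearMap.ker_domRestrict, inf_comm,
      ← LinearEquiv.finrank_eq (Submodule.comapSubtypeEquivOfLe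
        (inf_le_right : LinearMap.ker g ⊓ D ≤ D)),
      Submodule.comap_inf, Submodule.comap_subtype_self, inf_top_eq]
  omega

/-- Counting form of the dimension bound: the nested sets `A i` play the role of the pivots of the
row codes. -/
theorem sum_le_sum_sub_card {m n : ℕ} {A : Fin m → Finset (Fin n)} (hA : Monotone A)
    {k l : ℕ → ℕ} (hk : ∀ i : Fin m, k (i.1 + 1) ≤ (A i).card)
    (hlm : ∀ j : Fin n, l (j.1 + 1) ≤ m)
    (hl : ∀ j j' : Fin n, j ≤ j' → l (j.1 + 1) ≤ l (j'.1 + 1)) :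
    ∑ j ∈ Finset.Icc 1 n, ∑ i ∈ Finset.Icc (l (j - 1) + 1) (l j), max (k i + 1 - j) 0 ≤
      ∑ j : Fin n, (l (j.1 + 1) - (Finset.univ.filter fun i => j ∉ A i).card) := by
  have hshift : ∑ j ∈ Finset.Icc 1 n, ∑ i ∈ Finset.Icc (l (j - 1) + 1) (l j),
      max (k i + 1 - j) 0 =
      ∑ j : Fin n, ∑ x : Fin m, if l j ≤ x ∧ x.1 < l (j.1 + 1) then k (x.1 + 1) - j else 0 := by
    rw [← Finset.Ico_add_one_right_eq_Icc, Finset.sum_Ico_eq_sum_range, Nat.add_sub_cancel,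
      Finset.sum_range]
    refine Finset.sum_congr rfl fun j _ => ?_
    rw [← Finset.sum_filter]
    symm
    refine Finset.sum_bij (fun x _ => x.1 + 1) ?_ ?_ ?_ ?_
    · intro x hx
      simp only [Finset.mem_filter, Finset.mem_univ, true_and, Finset.mem_Icc] at hx ⊢
      rw [Nat.add_sub_cancel_left, Nat.add_comm 1]
      omega
    · intro x _ y _ h
      ext
      simpa using h
    · intro y hy
      rw [Finset.mem_Icc, Nat.add_sub_cancel_left, Nat.add_comm 1] at hy
      have := hlm j
      exact ⟨⟨y - 1, by omega⟩, by
        simp only [Finset.mem_filter, Finset.mem_univ, true_and]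
        omega, by simp only; omega⟩
    · intro x _
      simp only [Nat.max_zero]
      omega
  have hrow : ∀ x : Fin m,
      (∑ j : Fin n, if l j ≤ x ∧ x.1 < l (j.1 + 1) then k (x.1 + 1) - j else 0) ≤
      ∑ j : Fin n, if j ∈ A x ∧ x.1 < l (j.1 + 1) then 1 else 0 := by
    intro x
    by_cases h : ∃ j : Fin n, l j ≤ x ∧ x.1 < l (j.1 + 1)
    · obtain ⟨j₀, hj₀⟩ := h
      rw [Finset.sum_eq_single j₀]
      · rw [if_pos hj₀, ← Finset.card_filter]
        have hsub : A x \ Finset.Iio j₀ ⊆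
            Finset.univ.filter fun j : Fin n => j ∈ A x ∧ x.1 < l (j.1 + 1) := by
          intro j hj
          simp only [Finset.mem_sdiff, Finset.mem_Iio, not_lt, Finset.mem_filter,
            Finset.mem_univ, true_and] at hj ⊢
          exact ⟨hj.1, hj₀.2.trans_le (hl _ _ hj.2)⟩
        have h₁ := Finset.card_le_card hsub
        have h₂ := Finset.le_card_sdiff (Finset.Iio j₀) (A x)
        rw [Fin.card_Iio] at h₂
        have := hk x
        omega
      · intro j _ hj
        refine if_neg fun hx => ?_
        rcases lt_or_gt_of_ne hj with hlt | hlt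
        · have := hl j ⟨j₀.1 - 1, by omega⟩ (by rw [Fin.le_def]; simp only; omega)
          have e : j₀.1 - 1 + 1 = j₀.1 := by omega
          simp only [e] at this
          omega
        · have := hl j₀ ⟨j.1 - 1, by omega⟩ (by rw [Fin.le_def]; simp only; omega)
          have e : j.1 - 1 + 1 = j.1 := by omega
          simp only [e] at this
          omega
      · simp
    · rw [Finset.sum_eq_zero fun j _ => if_neg fun hx => h ⟨j, hx⟩]
      exact Nat.zero_le _
  have hcol : ∀ j : Fin n, (∑ x : Fin m, if j ∈ A x ∧ x.1 < l (j.1 + 1) then 1 else 0) ≤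
      l (j.1 + 1) - (Finset.univ.filter fun i => j ∉ A i).card := by
    intro j
    rw [← Finset.card_filter]
    rcases Finset.eq_empty_or_nonempty
      (Finset.univ.filter fun x : Fin m => j ∈ A x ∧ x.1 < l (j.1 + 1)) with h | ⟨x₀, hx₀⟩
    · rw [h]
      exact Nat.zero_le _
    · simp only [Finset.mem_filter, Finset.mem_univ, true_and] at hx₀
      apply Nat.le_sub_of_add_le
      rw [← Finset.card_union_of_disjoint]
      · calc _ ≤ (Finset.range (l (j.1 + 1))).card := by
              refine Finset.card_le_card_of_injOn Fin.val ?_ Fin.val_injective.injOn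
              intro x hx
              simp only [Finset.coe_union, Finset.coe_filter, Finset.mem_univ, true_and,
                Set.mem_union, Set.mem_ofPred_eq] at hx
              rw [Finset.coe_range, Set.mem_Iio]
              rcases hx with hx | hx
              · exact hx.2
              · have : x < x₀ := by
                  by_contra hle
                  exact hx (hA (not_lt.1 hle) hx₀.1)
                exact lt_trans this hx₀.2
          _ = _ := Finset.card_range _
      · rw [Finset.disjoint_filter]
        exact fun x _ hx hx' => hx' hx.1
  calc _ = _ := hshift
    _ = _ := Finset.sum_comm
    _ ≤ _ := Finset.sum_le_sum fun x _ => hrow x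
    _ = _ := Finset.sum_comm
    _ ≤ _ := Finset.sum_le_sum fun j _ => hcol j

/-- A product of subspaces of columns, multiplied on the right by an invertible matrix, has
dimension the sum of the dimensions. -/
theorem exists_submodule_mul_finrank_eq_sum {F : Type*} [Field F] {m n : ℕ}
    (W : Fin n → Submodule F (Fin m → F)) {c : Matrix (Fin n) (Fin n) F} (hc : IsUnit c) :
    ∃ P : Submodule F (Matrix (Fin m) (Fin n) F),
      Module.finrank F P = ∑ j, Module.finrank F (W j) ∧
      ∀ N ∈ P, ∃ w : Matrix (Fin m) (Fin n) F, (∀ j, w.col j ∈ W j) ∧ N = w * c := by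
  let f : (∀ j, W j) →ₗ[F] Matrix (Fin m) (Fin n) F :=
    { toFun := fun w => Matrix.of (fun i j => (w j).1 i) * c
      map_add' := fun w w' => by rw [← Matrix.add_mul]; rfl
      map_smul' := fun a w => by rw [RingHom.id_apply, ← Matrix.smul_mul]; rfl }
  obtain ⟨b, hb⟩ := hc.exists_right_inv
  have hf : Function.Injective f := by
    intro w w' h
    have h' := Matrix.mul_left_injective_of_inv c b hb h
    funext j
    ext i
    exact congrFun (congrFun h' i) j
  refine ⟨LinearMap.range f, ?_, ?_⟩
  · rw [LinearMap.finrank_range_of_inj hf, Module.finrank_pi_fintype]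
  · rintro _ ⟨w, rfl⟩
    exact ⟨Matrix.of (fun i j => (w j).1 i), fun j => (w j).2, rfl⟩


/-- Proposition 5.1, nested case, with equality: given nested chains of
row codes `C₁ ⊆ ⋯ ⊆ C_m ⊆ F^n` of dimensions `k₁ ≤ ⋯ ≤ k_m` and column codes
`D₁ ⊆ ⋯ ⊆ D_n ⊆ F^m` of dimensions `l₁ ≤ ⋯ ≤ l_n`, there exists a linear
`(m × n)`-matrix code of dimension
`K = Σ_{j=1}^n Σ_{i=l_{j-1}+1}^{l_j} max{k_i - j + 1, 0}` (with `l₀ = 0`) whose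
codewords have their `i`-th row in `C_i` and their `j`-th column in `D_j`.
(The dimensions are recorded via the functions `k, l : ℕ → ℕ`, 1-indexed, with
`k (i+1) = dim C_i` for `i : Fin m` and `l (j+1) = dim D_j` for `j : Fin n`, `l 0 = 0`;
in `ℕ`, the term `max (k i + 1 - j) 0` is exactly `max{k_i - j + 1, 0}` computed in `ℤ`.) -/
theorem stmt12 {F : Type*} [Field F] {m n : ℕ}
    (C : Fin m → Submodule F (Fin n → F)) (D : Fin n → Submodule F (Fin m → F))
    (k l : ℕ → ℕ)
    (hkC : ∀ i : Fin m, Module.finrank F (C i) = k (i.1 + 1))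
    (hlD : ∀ j : Fin n, Module.finrank F (D j) = l (j.1 + 1))
    (hl0 : l 0 = 0)
    (hkmono : ∀ i i' : Fin m, i ≤ i' → k (i.1 + 1) ≤ k (i'.1 + 1))
    (hlmono : ∀ j j' : Fin n, j ≤ j' → l (j.1 + 1) ≤ l (j'.1 + 1))
    (hCmono : ∀ i i' : Fin m, i ≤ i' → C i ≤ C i')
    (hDmono : ∀ j j' : Fin n, j ≤ j' → D j ≤ D j') :
    ∃ P : Submodule F (Matrix (Fin m) (Fin n) F),
      Module.finrank F P
          = ∑ j ∈ Finset.Icc 1 n, ∑ i ∈ Finset.Icc (l (j - 1) + 1) (l j),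
              max (k i + 1 - j) 0
      ∧ ∀ N ∈ P, (∀ i : Fin m, N i ∈ C i) ∧ (∀ j : Fin n, (fun i => N i j) ∈ D j) := by
  obtain ⟨c, hct, hcd, hcC⟩ := exists_echelon_of_monotone (C := C) hCmono
  have hc : IsUnit c := by
    rw [Matrix.isUnit_iff_isUnit_det, Matrix.det_of_isUpperTriangular hct, isUnit_iff_ne_zero]
    exact Finset.prod_ne_zero_iff.2 fun j _ => hcd j
  let s : Fin n → Finset (Fin m) := fun j => Finset.univ.filter fun i => j ∉ pivots (C i)
  obtain ⟨P, hP, hPmem⟩ := exists_submodule_mul_finrank_eq_sum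
    (fun j => D j ⊓ LinearMap.ker (LinearMap.funLeft F F (Subtype.val : s j → Fin m))) hc
  have hle : ∑ j ∈ Finset.Icc 1 n, ∑ i ∈ Finset.Icc (l (j - 1) + 1) (l j),
      max (k i + 1 - j) 0 ≤ Module.finrank F P := by
    rw [hP]
    refine (sum_le_sum_sub_card (A := fun i => pivots (C i))
      (fun i i' h => pivots_mono (hCmono i i' h)) (fun i => ?_) (fun j => ?_) hlmono).trans
      (Finset.sum_le_sum fun j _ => ?_)
    · rw [← hkC]
      exact finrank_le_card_pivots _
    · rw [← hlD]
      simpa using Submodule.finrank_le (D j)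
    · rw [← hlD, Nat.sub_le_iff_le_add]
      exact finrank_le_finrank_inf_vanishing (D j) (s j)
  obtain ⟨b, hb⟩ := exists_linearIndependent_of_le_finrank hle
  refine ⟨Submodule.span F (Set.range (P.subtype ∘ b)), ?_, fun N hN => ?_⟩
  · rw [finrank_span_eq_card (hb.map' P.subtype P.ker_subtype), Fintype.card_fin]
  have hNP : N ∈ P := Submodule.span_le.2 (Set.range_subset_iff.2 fun x => (b x).2) hN
  obtain ⟨w, hw, rfl⟩ := hPmem N hNP
  constructor
  · intro i
    have hrow : (w * c) i = ∑ j, w i j • c j := by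
      ext j'
      simp [Matrix.mul_apply]
    rw [hrow]
    refine Submodule.sum_mem _ fun j _ => ?_
    by_cases hj : j ∈ pivots (C i)
    · exact Submodule.smul_mem _ _ (hcC i j hj)
    · have h0 : w i j = 0 := congrFun (hw j).2 ⟨i, by simp [s, hj]⟩
      rw [h0, zero_smul]
      exact Submodule.zero_mem _
  · intro j'
    have hcol : (fun i => (w * c) i j') = ∑ j, c j j' • w.col j := by
      ext i
      simp [Matrix.mul_apply, mul_comm]
    rw [hcol]
    refine Submodule.sum_mem _ fun j _ => ?_
    rcases le_or_gt j j' with h | h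
    · exact Submodule.smul_mem _ _ (hDmono j j' h (hw j).1)
    · have h0 : c j j' = 0 := hct h
      rw [h0, zero_smul]
      exact Submodule.zero_mem _
end

section
/- For i ∈ [m] let C_i be a linear code of length n and dimension k_i over F_q with j_n ∈ C_i, and for j ∈ [n] let D_j be a linear code of length m and dimension l_j with j_m ∈ D_j, where k₁ ≤ ⋯ ≤ k_m, l₁ ≤ ⋯ ≤ l_n, C₁ ⊆ ⋯ ⊆ C_m, and D₁ ⊆ ⋯ ⊆ D_n. Let u = (0_{k_m}, a) ∈ F_q^n and v = (0_{l_n}, b) ∈ F_q^m. Then there exists an affine (m×n)-matrix code over F_q, namely a translate 𝒩 + U of the linear irregular product code 𝒩 of dimension K = Σ_{j=1}^{n} Σ_{i=l_{j−1}+1}^{l_j} max{k_i − j + 1, 0} (with l₀ = 0), where U is the m×n matrix ((0_{l_n×k_m}, j_{l_n}ᵀa),(bᵀj_{k_m}, bᵀj_{n−k_m} + j_{m−l_n}ᵀa)), such that every codeword N satisfies: the i-th row of N belongs to the coset C_i + u for every i ∈ [m], and the j-th column of N belongs to the coset D_j + v for every j ∈ [n]. -/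
/-- The positions at which some vector of `D` has its first nonzero coordinate. -/
noncomputable def leadingPositions {F : Type*} [Field F] {m : ℕ}
    (D : Submodule F (Fin m → F)) : Finset (Fin m) :=
  open Classical in {p | ∃ d ∈ D, d p ≠ 0 ∧ ∀ t < p, d t = 0}

theorem mem_leadingPositions {F : Type*} [Field F] {m : ℕ} {D : Submodule F (Fin m → F)}
    {p : Fin m} : p ∈ leadingPositions D ↔ ∃ d ∈ D, d p ≠ 0 ∧ ∀ t < p, d t = 0 := by
  simp [leadingPositions]

theorem leadingPositions_mono {F : Type*} [Field F] {m : ℕ} {D D' : Submodule F (Fin m → F)}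
    (h : D ≤ D') : leadingPositions D ⊆ leadingPositions D' := by
  intro p
  simp only [mem_leadingPositions]
  rintro ⟨d, hd, hp⟩
  exact ⟨d, h hd, hp⟩

theorem finrank_le_card_leadingPositions {F : Type*} [Field F] {m : ℕ}
    (D : Submodule F (Fin m → F)) : Module.finrank F D ≤ (leadingPositions D).card := by
  let f : D →ₗ[F] (leadingPositions D → F) :=
    (LinearMap.funLeft F F (Subtype.val : leadingPositions D → Fin m)).comp D.subtype
  have hf : Function.Injective f := by
    rw [injective_iff_map_eq_zero]
    rintro ⟨d, hd⟩ h
    by_contra hne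
    have hex : ∃ p, d p ≠ 0 := by
      by_contra! h0
      exact hne (Subtype.ext (funext h0))
    obtain ⟨p, hp, hmin⟩ := WellFounded.has_min (wellFounded_lt (α := Fin m)) {p | d p ≠ 0} hex
    have hlead : p ∈ leadingPositions D :=
      mem_leadingPositions.2 ⟨d, hd, hp, fun t ht => by_contra fun h' => hmin t h' ht⟩
    exact hp (congrFun h ⟨p, hlead⟩)
  simpa using LinearMap.finrank_le_finrank_of_injective hf

theorem finrank_le_of_submodule_pi {F : Type*} [Field F] {m : ℕ}
    (D : Submodule F (Fin m → F)) : Module.finrank F D ≤ m := by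
  simpa using D.finrank_le

/-- A family that is triangular with respect to a family of functionals indexed by the same
partially ordered type is linearly independent. -/
theorem linearIndependent_of_triangular {F M ι : Type*} [Field F] [AddCommGroup M] [Module F M]
    [PartialOrder ι] (v : ι → M) (φ : ι → M →ₗ[F] F)
    (hzero : ∀ x y, ¬ x ≤ y → φ y (v x) = 0) (hdiag : ∀ x, φ x (v x) ≠ 0) :
    LinearIndependent F v := by
  classical
  rw [linearIndependent_iff']
  intro s g hg
  by_contra! hne
  obtain ⟨i, hi, hgi⟩ := hne
  obtain ⟨x, hx⟩ := (s.filter (g · ≠ 0)).exists_minimal ⟨i, by simp [hi, hgi]⟩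
  have hxs : x ∈ s ∧ g x ≠ 0 := by simpa using hx.prop
  have h := congrArg (φ x) hg
  rw [map_sum, map_zero, Finset.sum_eq_single_of_mem x hxs.1] at h
  · simp [hxs.2, hdiag] at h
  · intro y hy hyx
    by_cases hgy : g y = 0
    · simp [hgy]
    · have hle : ¬ y ≤ x := fun hle =>
        hyx (le_antisymm hle (hx.le_of_le (by simp [hy, hgy]) hle))
      simp [hzero y x hle]

/-- Among the sets of a given size, an initial segment meets an upper set in the fewest points. -/
theorem card_filter_lt_le_card_inter_of_upper {n : ℕ} (A U : Finset (Fin n)) (c : ℕ)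
    (hc : c ≤ A.card) (hU : ∀ s ∈ U, ∀ t, s ≤ t → t ∈ U) :
    (U.filter fun s => s.1 < c).card ≤ (A ∩ U).card := by
  by_cases h : ∃ s, s ∉ U ∧ c ≤ s.1
  · obtain ⟨s, hs, hcs⟩ := h
    have : U.filter (fun s => s.1 < c) = ∅ := by
      refine Finset.filter_eq_empty_iff.2 fun t ht htc => hs (hU t ht s ?_)
      exact Fin.le_def.2 (by omega)
    simp [this]
  · push Not at h
    have h₁ : (A \ U).card ≤ (Finset.univ \ U).card :=
      Finset.card_le_card (Finset.sdiff_subset_sdiff (Finset.subset_univ A) subset_rfl)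
    have h₂ : (U.filter fun s => s.1 < c).card + (Finset.univ \ U).card ≤ c := by
      rw [← Finset.card_union_of_disjoint]
      · calc _ ≤ (Finset.range c).card := by
              refine Finset.card_le_card_of_injOn Fin.val ?_ Fin.val_injective.injOn
              intro s hs
              simp only [Finset.coe_union, Set.mem_union, Finset.mem_coe, Finset.mem_filter,
                Finset.mem_sdiff, Finset.mem_univ, true_and] at hs
              simpa using hs.elim And.right (h s)
          _ = c := Finset.card_range c
      · exact Finset.disjoint_left.2 fun s hs hs' =>
          (Finset.mem_sdiff.1 hs').2 (Finset.mem_filter.1 hs).1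
    have h₃ := Finset.card_inter_add_card_sdiff A U
    omega

theorem sum_consecutive_Icc (l : ℕ → ℕ) (hl0 : l 0 = 0) (f : ℕ → ℕ) (s : ℕ)
    (hl : ∀ j < s, l j ≤ l (j + 1)) :
    ∑ j ∈ Finset.Icc 1 s, ∑ i ∈ Finset.Icc (l (j - 1) + 1) (l j), f i
      = ∑ i ∈ Finset.Icc 1 (l s), f i := by
  induction s with
  | zero => simp [hl0]
  | succ s ih =>
    rw [Finset.sum_Icc_succ_top (by omega), ih fun j hj => hl j (by omega)]
    have := Finset.sum_Ioc_consecutive f (Nat.zero_le (l s)) (hl s (by omega))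
    simpa only [← Finset.Icc_add_one_left_eq_Ioc, zero_add, Nat.add_sub_cancel] using this

/-- The dimension formula for irregular products, counted column by column. -/
theorem sum_irregular_eq_sum_card {n : ℕ} (k l : ℕ → ℕ) (hl0 : l 0 = 0)
    (hl : ∀ j < n, l j ≤ l (j + 1)) (hk : ∀ i ∈ Finset.Icc 1 (l n), k i ≤ n) :
    ∑ j ∈ Finset.Icc 1 n, ∑ i ∈ Finset.Icc (l (j - 1) + 1) (l j), max (k i + 1 - j) 0
      = ∑ s ∈ Finset.Icc 1 n, ((Finset.Icc 1 (l s)).filter fun i => s ≤ k i).card := by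
  have hlmono : ∀ j ≤ n, l j ≤ l n := fun j hj =>
    Nat.le_induction (m := j) (P := fun r _ => r ≤ n → l j ≤ l r) (fun _ => le_rfl)
      (fun r _ ih hr => (ih (by omega)).trans (hl r (by omega))) n hj le_rfl
  have hterm : ∀ j ∈ Finset.Icc 1 n, ∀ i ∈ Finset.Icc (l (j - 1) + 1) (l j),
      max (k i + 1 - j) 0
        = ∑ s ∈ Finset.Icc 1 n, if j ≤ s then (if s ≤ k i then 1 else 0) else 0 := by
    intro j hj i hi
    simp only [Finset.mem_Icc] at hj hi
    have hkn : k i ≤ n := hk i (Finset.mem_Icc.2 ⟨by omega, hi.2.trans (hlmono j hj.2)⟩)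
    simp only [← ite_and, ← Finset.card_filter]
    have : (Finset.Icc 1 n).filter (fun s => j ≤ s ∧ s ≤ k i) = Finset.Icc j (k i) := by
      ext s
      simp only [Finset.mem_filter, Finset.mem_Icc]
      omega
    simp [this]
  rw [Finset.sum_congr rfl fun j hj => Finset.sum_congr rfl (hterm j hj)]
  rw [Finset.sum_congr rfl fun j _ => Finset.sum_comm, Finset.sum_comm]
  refine Finset.sum_congr rfl fun s hs => ?_
  simp only [Finset.mem_Icc] at hs
  rw [Finset.card_filter, ← sum_consecutive_Icc l hl0 _ s fun j hj => hl j (by omega)]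
  have : Finset.Icc 1 s = (Finset.Icc 1 n).filter (· ≤ s) := by
    ext j
    simp only [Finset.mem_filter, Finset.mem_Icc]
    omega
  rw [this, Finset.sum_filter]
  refine Finset.sum_congr rfl fun j _ => ?_
  split_ifs <;> simp

/-- The pairs `(p, q)` such that `C p` has a vector led by `q` and `D q` a vector led by `p`. -/
noncomputable def leadingPairs {F : Type*} [Field F] {m n : ℕ}
    (C : Fin m → Submodule F (Fin n → F)) (D : Fin n → Submodule F (Fin m → F)) :
    Finset (Fin m × Fin n) :=
  {x | x.2 ∈ leadingPositions (C x.1) ∧ x.1 ∈ leadingPositions (D x.2)}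

theorem sum_card_le_card_leadingPairs {F : Type*} [Field F] {m n : ℕ}
    (C : Fin m → Submodule F (Fin n → F)) (D : Fin n → Submodule F (Fin m → F))
    (hC : Monotone C) (hD : Monotone D) :
    ∑ s : Fin n, (Finset.univ.filter fun i : Fin m =>
        i.1 < Module.finrank F (D s) ∧ s.1 < Module.finrank F (C i)).card
      ≤ (leadingPairs C D).card := by
  have hrow : ∀ p : Fin m, (Finset.univ.filter fun s : Fin n =>
        p ∈ leadingPositions (D s) ∧ s.1 < Module.finrank F (C p)).card
      ≤ (Finset.univ.filter fun s : Fin n =>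
        s ∈ leadingPositions (C p) ∧ p ∈ leadingPositions (D s)).card := by
    intro p
    have h := card_filter_lt_le_card_inter_of_upper (leadingPositions (C p))
      (Finset.univ.filter fun s : Fin n => p ∈ leadingPositions (D s)) _
      (finrank_le_card_leadingPositions (C p)) (by
        intro s hs t hst
        simp only [Finset.mem_filter, Finset.mem_univ, true_and] at hs ⊢
        exact leadingPositions_mono (hD hst) hs)
    rw [Finset.filter_filter] at h
    refine h.trans (Finset.card_le_card fun s => ?_)
    simp
  have hcol : ∀ s : Fin n, (Finset.univ.filter fun i : Fin m =>
        i.1 < Module.finrank F (D s) ∧ s.1 < Module.finrank F (C i)).card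
      ≤ (Finset.univ.filter fun p : Fin m =>
        p ∈ leadingPositions (D s) ∧ s.1 < Module.finrank F (C p)).card := by
    intro s
    have h := card_filter_lt_le_card_inter_of_upper (leadingPositions (D s))
      (Finset.univ.filter fun p : Fin m => s.1 < Module.finrank F (C p)) _
      (finrank_le_card_leadingPositions (D s)) (by
        intro i hi t hit
        simp only [Finset.mem_filter, Finset.mem_univ, true_and] at hi ⊢
        exact hi.trans_le (Submodule.finrank_mono (hC hit)))
    rw [Finset.filter_filter] at h
    simp only [and_comm (a := _ < Module.finrank F (D s))]
    refine h.trans (Finset.card_le_card fun p => ?_)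
    simp
  calc _ ≤ ∑ s : Fin n, (Finset.univ.filter fun p : Fin m =>
        p ∈ leadingPositions (D s) ∧ s.1 < Module.finrank F (C p)).card :=
        Finset.sum_le_sum fun s _ => hcol s
    _ = ∑ p : Fin m, (Finset.univ.filter fun s : Fin n =>
        p ∈ leadingPositions (D s) ∧ s.1 < Module.finrank F (C p)).card := by
        simp only [Finset.card_filter]
        exact Finset.sum_comm
    _ ≤ ∑ p : Fin m, (Finset.univ.filter fun s : Fin n =>
        s ∈ leadingPositions (C p) ∧ p ∈ leadingPositions (D s)).card :=
        Finset.sum_le_sum fun p _ => hrow p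
    _ = (leadingPairs C D).card := by
        simp only [leadingPairs, Finset.card_filter]
        rw [Fintype.sum_prod_type]

/-- Nested row and column codes admit an irregular product code of every dimension up to the
number of leading pairs. -/
theorem exists_irregular_product {F : Type*} [Field F] {m n : ℕ}
    (C : Fin m → Submodule F (Fin n → F)) (D : Fin n → Submodule F (Fin m → F))
    (hC : Monotone C) (hD : Monotone D) (K : ℕ) (hK : K ≤ (leadingPairs C D).card) :
    ∃ P : Submodule F (Matrix (Fin m) (Fin n) F), Module.finrank F P = K ∧
      ∀ N ∈ P, (∀ i, N i ∈ C i) ∧ (∀ j, (fun i => N i j) ∈ D j) := by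
  obtain ⟨T, hT, rfl⟩ := Finset.exists_subset_card_eq hK
  have hmem : ∀ x : T, x.1.2 ∈ leadingPositions (C x.1.1) ∧
      x.1.1 ∈ leadingPositions (D x.1.2) := fun x => by
    simpa [leadingPairs] using hT x.2
  simp only [mem_leadingPositions] at hmem
  choose hc hd using hmem
  choose c hcC hc₁ hc₀ using hc
  choose d hdD hd₁ hd₀ using hd
  let N : T → Matrix (Fin m) (Fin n) F := fun x => Matrix.vecMulVec (d x) (c x)
  have hN : LinearIndependent F N := by
    refine linearIndependent_of_triangular N (fun y => Matrix.entryLinearMap F F y.1.1 y.1.2)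
      (fun x y hxy => ?_) fun x => by simp [N, Matrix.vecMulVec_apply, hc₁, hd₁]
    have : ¬ (x.1.1 ≤ y.1.1 ∧ x.1.2 ≤ y.1.2) := hxy
    rw [not_and_or, not_le, not_le] at this
    rcases this with h | h
    · simp [N, Matrix.vecMulVec_apply, hd₀ x _ h]
    · simp [N, Matrix.vecMulVec_apply, hc₀ x _ h]
  refine ⟨Submodule.span F (Set.range N), by simpa using finrank_span_eq_card hN, ?_⟩
  intro A hA
  induction hA using Submodule.span_induction with
  | mem A hA =>
    obtain ⟨x, rfl⟩ := hA
    refine ⟨fun i => ?_, fun j => ?_⟩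
    · rcases lt_or_ge i x.1.1 with h | h
      · convert (C i).zero_mem
        ext j
        simp [N, Matrix.vecMulVec_apply, hd₀ x i h]
      · exact (C i).smul_mem (d x i) (hC h (hcC x))
    · rcases lt_or_ge j x.1.2 with h | h
      · convert (D j).zero_mem
        simp [N, Matrix.vecMulVec_apply, hc₀ x j h]
      · convert (D j).smul_mem (c x j) (hD h (hdD x)) using 1
        ext i
        simp [N, Matrix.vecMulVec_apply, mul_comm]
  | zero => exact ⟨fun i => (C i).zero_mem, fun j => (D j).zero_mem⟩
  | add A B _ _ hA hB =>
    exact ⟨fun i => (C i).add_mem (hA.1 i) (hB.1 i), fun j => (D j).add_mem (hA.2 j) (hB.2 j)⟩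
  | smul a A _ hA =>
    exact ⟨fun i => (C i).smul_mem a (hA.1 i), fun j => (D j).smul_mem a (hA.2 j)⟩


/-- Proposition 5.3, nested case: irregular product of affine codes.
Given nested chains of row codes `C₁ ⊆ ⋯ ⊆ C_m ⊆ F^n` (each containing `j_n`) of
dimensions `k₁ ≤ ⋯ ≤ k_m` and column codes `D₁ ⊆ ⋯ ⊆ D_n ⊆ F^m` (each containing `j_m`)
of dimensions `l₁ ≤ ⋯ ≤ l_n`, and translates `u = (0_{k_m}, a) ∈ F^n`,
`v = (0_{l_n}, b) ∈ F^m` (i.e. `u` vanishes on the first `k_m` coordinates and `v` on the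
first `l_n` coordinates), there is a translate `𝒩 + U` of the linear irregular product
code `𝒩` of dimension `K = Σ_{j=1}^n Σ_{i=l_{j-1}+1}^{l_j} max{k_i - j + 1, 0}` (with
`l₀ = 0`) such that every codeword has its `i`-th row in `C_i + u` and its `j`-th column
in `D_j + v`.  Here `U = ((0_{l_n×k_m}, j_{l_n}ᵀa), (bᵀj_{k_m}, bᵀj_{n-k_m} + j_{m-l_n}ᵀa))`,
written entrywise as `U i j = (if j < k_m then 0 else u j) + (if i < l_n then 0 else v i)`
(recall `u j = a j` for `j ≥ k_m` and `v i = b i` for `i ≥ l_n`). -/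
theorem stmt13 {F : Type*} [Field F] {m n : ℕ}
    (C : Fin m → Submodule F (Fin n → F)) (D : Fin n → Submodule F (Fin m → F))
    (k l : ℕ → ℕ)
    (hkC : ∀ i : Fin m, Module.finrank F (C i) = k (i.1 + 1))
    (hlD : ∀ j : Fin n, Module.finrank F (D j) = l (j.1 + 1))
    (hl0 : l 0 = 0)
    (hkmono : ∀ i i' : Fin m, i ≤ i' → k (i.1 + 1) ≤ k (i'.1 + 1))
    (hlmono : ∀ j j' : Fin n, j ≤ j' → l (j.1 + 1) ≤ l (j'.1 + 1))
    (hCmono : ∀ i i' : Fin m, i ≤ i' → C i ≤ C i')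
    (hDmono : ∀ j j' : Fin n, j ≤ j' → D j ≤ D j')
    (hjC : ∀ i : Fin m, (fun _ => (1 : F)) ∈ C i)
    (hjD : ∀ j : Fin n, (fun _ => (1 : F)) ∈ D j)
    (u : Fin n → F) (hu : ∀ t : Fin n, (t : ℕ) < k m → u t = 0)
    (v : Fin m → F) (hv : ∀ t : Fin m, (t : ℕ) < l n → v t = 0) :
    ∃ P : Submodule F (Matrix (Fin m) (Fin n) F),
      Module.finrank F P
          = ∑ j ∈ Finset.Icc 1 n, ∑ i ∈ Finset.Icc (l (j - 1) + 1) (l j),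
              max (k i + 1 - j) 0
      ∧ (∀ N ∈ P, (∀ i : Fin m, N i ∈ C i) ∧ (∀ j : Fin n, (fun i => N i j) ∈ D j))
      ∧ ∀ N' ∈ (fun N : Matrix (Fin m) (Fin n) F =>
            N + Matrix.of fun (i : Fin m) (j : Fin n) =>
              (if (j : ℕ) < k m then 0 else u j) + (if (i : ℕ) < l n then 0 else v i))
          '' (P : Set (Matrix (Fin m) (Fin n) F)),
          (∀ i : Fin m, ∃ c ∈ C i, N' i = c + u)
          ∧ (∀ j : Fin n, ∃ d ∈ D j, (fun i => N' i j) = d + v) := by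
  have hlm : ∀ j < n, l (j + 1) ≤ m := fun j hj => by
    simpa [hlD ⟨j, hj⟩] using finrank_le_of_submodule_pi (D ⟨j, hj⟩)
  have hlstep : ∀ j < n, l j ≤ l (j + 1) := by
    rintro (_ | j) hj
    · simp [hl0]
    · exact hlmono ⟨j, by omega⟩ ⟨j + 1, hj⟩ (Fin.le_def.2 (by simp))
  have hln : l n ≤ m := by
    rcases n with _ | n
    · simp [hl0]
    · exact hlm n (by omega)
  have hkn : ∀ i ∈ Finset.Icc 1 (l n), k i ≤ n := by
    intro i hi
    simp only [Finset.mem_Icc] at hi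
    obtain ⟨i, rfl⟩ := Nat.exists_eq_add_of_le' hi.1
    have hi' : i < m := by omega
    simpa [hkC ⟨i, hi'⟩] using finrank_le_of_submodule_pi (C ⟨i, hi'⟩)
  have hK : ∑ j ∈ Finset.Icc 1 n, ∑ i ∈ Finset.Icc (l (j - 1) + 1) (l j), max (k i + 1 - j) 0
      ≤ (leadingPairs C D).card := by
    refine le_trans (le_of_eq ?_) (sum_card_le_card_leadingPairs C D
      (fun i i' h => hCmono i i' h) (fun j j' h => hDmono j j' h))
    rw [sum_irregular_eq_sum_card k l hl0 hlstep hkn, ← Finset.Ico_add_one_right_eq_Icc,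
      Finset.sum_Ico_eq_sum_range, Nat.add_sub_cancel, Finset.sum_range]
    simp only [add_comm 1]
    refine Finset.sum_congr rfl fun s _ => Eq.symm ?_
    refine Finset.card_bij (fun i _ => i.1 + 1) ?_ ?_ ?_
    · intro i hi
      simp only [Finset.mem_filter, Finset.mem_univ, true_and, hlD, hkC, Finset.mem_Icc] at hi ⊢
      omega
    · intro i _ i' _ h
      exact Fin.ext (by omega)
    · intro i hi
      simp only [Finset.mem_filter, Finset.mem_Icc] at hi
      obtain ⟨i, rfl⟩ := Nat.exists_eq_add_of_le' hi.1.1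
      have := hlm s s.2
      refine ⟨⟨i, by omega⟩, ?_, rfl⟩
      simp only [Finset.mem_filter, Finset.mem_univ, true_and, hlD, hkC]
      omega
  obtain ⟨P, hP, hPmem⟩ := exists_irregular_product C D
    (fun i i' h => hCmono i i' h) (fun j j' h => hDmono j j' h) _ hK
  refine ⟨P, hP, hPmem, ?_⟩
  have hu' : ∀ j : Fin n, (if (j : ℕ) < k m then 0 else u j) = u j := fun j => by
    split_ifs with h
    exacts [(hu j h).symm, rfl]
  have hv' : ∀ i : Fin m, (if (i : ℕ) < l n then 0 else v i) = v i := fun i => by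
    split_ifs with h
    exacts [(hv i h).symm, rfl]
  simp only [hu', hv']
  rintro _ ⟨N, hN, rfl⟩
  obtain ⟨hrow, hcol⟩ := hPmem N hN
  refine ⟨fun i => ⟨N i + v i • fun _ => 1, (C i).add_mem (hrow i) ((C i).smul_mem _ (hjC i)), ?_⟩,
    fun j => ⟨(fun i => N i j) + u j • fun _ => 1,
      (D j).add_mem (hcol j) ((D j).smul_mem _ (hjD j)), ?_⟩⟩
  · ext j
    simp
    ring
  · ext i
    simp
    ring
end
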